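/- Let φ be a smooth real-valued function on ℝ^n all of whose derivatives have at most polynomial growth, and assume there exist δ > 1 and a continuous seminorm C(·) on the Schwartz space S(ℝ^n) such that for every λ ≥ 1 and every Schwartz function f, |∫_{ℝ^n} e^{iλφ(x)} f(x) dx| ≤ λ^{−δ} C(f). For T ≥ 1 let D_T be the tempered distribution given by the bounded function x ↦ −(e^{iTφ(x)} − 1)/φ(x) (interpreted as −iT at points where φ(x) = 0). Then the family (D_T)_{T ≥ 1} converges in the space of tempered distributions S′(ℝ^n) as T → ∞; that is, for every Schwartz function f, the limit lim_{T→∞} ⟨D_T, f⟩ = lim_{T→∞} (−∫_{ℝ^n} ((e^{iTφ(x)} − 1)/φ(x)) f(x) dx) exists. -/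

import Mathlib

open MeasureTheory Filter Complex SchwartzMap
open scoped RealInnerProductSpace ENNReal

noncomputable section

/-- Euclidean space `ℝ^n`. -/
abbrev E (n : ℕ) : Type := EuclideanSpace ℝ (Fin n)

/-- The truncated reciprocal `D_T = -(e^{iTφ} - 1)/φ`, interpreted as `-iT` where `φ = 0`. -/
def DT {n : ℕ} (φ : E n → ℝ) (T : ℝ) (x : E n) : ℂ :=
  if φ x = 0 then -(Complex.I * (T : ℂ))
  else -(Complex.exp (Complex.I * ((T * φ x : ℝ) : ℂ)) - 1) / ((φ x : ℝ) : ℂ)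

/-- If `φ` is smooth with polynomially growing derivatives and satisfies
the oscillatory decay `|∫ e^{iλφ} f| ≤ λ^{-δ} C(f)` for some `δ > 1` and a continuous
seminorm `C` on the Schwartz space, then the distributions `D_T = -(e^{iTφ}-1)/φ` converge
in `𝒮'(ℝ^n)` as `T → ∞` (the limit being the finite part `F.P.(1/φ)`). -/
theorem statement18 {n : ℕ} (φ : E n → ℝ) (hφs : ContDiff ℝ (⊤ : ℕ∞) φ)
    (hgrowth : ∀ k : ℕ, ∃ C N : ℝ, ∀ x : E n,
      ‖iteratedFDeriv ℝ k φ x‖ ≤ C * (1 + ‖x‖) ^ N)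
    (δ : ℝ) (hδ : 1 < δ) (Cs : Seminorm ℝ 𝓢(E n, ℂ)) (hCs : Continuous Cs)
    (hdecay : ∀ lam : ℝ, 1 ≤ lam → ∀ f : 𝓢(E n, ℂ),
      ‖∫ x : E n, Complex.exp (Complex.I * ((lam * φ x : ℝ) : ℂ)) * f x‖ ≤
        lam ^ (-δ) * Cs f) :
    ∀ f : 𝓢(E n, ℂ), ∃ L : ℂ,
      Tendsto (fun T : ℝ => ∫ x : E n, DT φ T x * f x) atTop (nhds L) := by
  intro f
  have hφc : Continuous φ := hφs.continuous
  have hfi : Integrable (fun x => f x) (volume : Measure (E n)) := f.integrable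
  have hnorm : ∀ r : ℝ, ‖Complex.exp (Complex.I * (r : ℂ))‖ = 1 := by
    intro r
    rw [mul_comm]
    exact Complex.norm_exp_ofReal_mul_I r
  set G : ℝ → ℂ := fun lam => ∫ x : E n, Complex.exp (Complex.I * ((lam * φ x : ℝ) : ℂ)) * f x
    with hG
  have hGc : Continuous G := by
    refine continuous_of_dominated (bound := fun x => ‖f x‖) ?_ ?_ hfi.norm ?_
    · intro lam
      have : Continuous fun x : E n =>
          Complex.exp (Complex.I * ((lam * φ x : ℝ) : ℂ)) * f x := by
        have := f.continuous
        fun_prop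
      exact this.aestronglyMeasurable
    · intro lam
      refine Eventually.of_forall fun x => ?_
      rw [norm_mul, hnorm, one_mul]
    · refine Eventually.of_forall fun x => ?_
      fun_prop
  have hG1 : IntegrableOn G (Set.Ioi 1) := by
    have h1 : IntegrableOn (fun lam : ℝ => lam ^ (-δ) * Cs f) (Set.Ioi 1) :=
      (integrableOn_Ioi_rpow_of_lt (by linarith) one_pos).mul_const _
    refine Integrable.mono' h1 hGc.aestronglyMeasurable ?_
    refine (ae_restrict_mem measurableSet_Ioi).mono fun lam hl => ?_
    exact hdecay lam (le_of_lt hl) f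
  have hG0 : IntegrableOn G (Set.Ioi 0) := by
    rw [← Set.Ioc_union_Ioi_eq_Ioi (zero_le_one (α := ℝ))]
    exact (hGc.integrableOn_Ioc).union hG1
  have hlim := (intervalIntegral_tendsto_integral_Ioi 0 hG0 tendsto_id).const_mul (-Complex.I)
  refine ⟨_, hlim.congr' ?_⟩
  filter_upwards [eventually_ge_atTop 0] with T hT
  have hDT : ∀ x : E n, DT φ T x
      = -Complex.I * ∫ lam in (0:ℝ)..T, Complex.exp (Complex.I * ((lam * φ x : ℝ) : ℂ)) := by
    intro x
    unfold DT
    split_ifs with h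
    · simp [h]
    · have hne : Complex.I * (φ x : ℂ) ≠ 0 := mul_ne_zero Complex.I_ne_zero (by exact_mod_cast h)
      have hp : (φ x : ℂ) ≠ 0 := by exact_mod_cast h
      have e : ∀ lam : ℝ, Complex.exp (Complex.I * ((lam * φ x : ℝ) : ℂ))
          = Complex.exp ((Complex.I * (φ x : ℂ)) * lam) := by
        intro lam; congr 1; push_cast; ring
      simp_rw [e]
      rw [integral_exp_mul_complex hne]
      simp only [Complex.ofReal_zero, mul_zero, Complex.exp_zero]
      field_simp
  have hint : Integrable (fun p : ℝ × E n =>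
      Complex.exp (Complex.I * ((p.1 * φ p.2 : ℝ) : ℂ)) * f p.2)
      ((volume.restrict (Set.Ioc 0 T)).prod volume) := by
    have h2 : Integrable (fun p : ℝ × E n => f p.2)
      ((volume.restrict (Set.Ioc 0 T)).prod volume) := hfi.comp_snd _
    refine h2.norm.mono' ?_ ?_
    · have : Continuous fun p : ℝ × E n =>
          Complex.exp (Complex.I * ((p.1 * φ p.2 : ℝ) : ℂ)) * f p.2 := by
        have := f.continuous
        fun_prop
      exact this.aestronglyMeasurable
    · refine Eventually.of_forall fun p => ?_
      rw [norm_mul, hnorm, one_mul]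
  simp_rw [hDT, mul_assoc, id, intervalIntegral.integral_of_le hT]
  rw [integral_const_mul, hG, integral_integral_swap hint]
  simp_rw [integral_mul_const]
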